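/- Let E and F be real inner product spaces, let K ≥ 0 and μ > 0, let b : E → F be K-Lipschitz, and let r : E → ℝ. Suppose that for every p ∈ F the function u ↦ ⟨p, b(u)⟩ − r(u) is μ-strongly concave (i.e., u ↦ ⟨p, b(u)⟩ − r(u) + (μ/2)‖u‖² is concave) and attains its maximum at a point u^⋄(p) ∈ E. Then the map p ↦ u^⋄(p) is (K/μ)-Lipschitz: for all p₁, p₂ ∈ F, ‖u^⋄(p₁) − u^⋄(p₂)‖ ≤ (K/μ) ‖p₁ − p₂‖. -/

import Mathlib

open scoped RealInnerProductSpace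

/-- A strongly concave function grows at least quadratically away from a maximizer. -/
theorem StrongConcaveOn.add_sq_le_of_isMaxOn
    {E : Type*} [NormedAddCommGroup E] [NormedSpace ℝ E] {s : Set E} {f : E → ℝ} {m : ℝ}
    (hf : StrongConcaveOn s m f) {x y : E} (hx : x ∈ s) (hy : y ∈ s) (hmax : IsMaxOn f s x) :
    f y + m / 2 * ‖x - y‖ ^ 2 ≤ f x := by
  have key : ∀ a : ℝ, 0 < a → a < 1 → a * (m / 2 * ‖x - y‖ ^ 2) ≤ f x - f y := by
    intro a ha ha1
    have hb : 0 < 1 - a := sub_pos.2 ha1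
    have hconc := hf.2 hx hy ha.le hb.le (by ring)
    have hle : f (a • x + (1 - a) • y) ≤ f x := hmax (hf.1 hx hy ha.le hb.le (by ring))
    simp only [smul_eq_mul] at hconc
    refine le_of_mul_le_mul_left ?_ hb
    linarith
  have hyx : f y ≤ f x := hmax hy
  by_contra! h
  have hc : 0 < m / 2 * ‖x - y‖ ^ 2 := by linarith
  have := key ((m / 2 * ‖x - y‖ ^ 2 + (f x - f y)) / (2 * (m / 2 * ‖x - y‖ ^ 2)))
    (div_pos (by linarith) (by linarith)) ((div_lt_one (by linarith)).2 (by linarith))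
  rw [div_mul_eq_mul_div, div_le_iff₀ (by linarith)] at this
  nlinarith

/-- Lipschitz dependence of the maximizer of the generalized Hamiltonian on the
costate: if `b` is `K`-Lipschitz and for every `p` the function
`u ↦ ⟪p, b u⟫ - r u` is `μ`-strongly concave with maximizer `u^⋄(p)`, then
`p ↦ u^⋄(p)` is `(K/μ)`-Lipschitz. -/
theorem maximizer_lipschitz_in_costate
    {E F : Type*} [NormedAddCommGroup E] [InnerProductSpace ℝ E]
    [NormedAddCommGroup F] [InnerProductSpace ℝ F]
    (K μ : ℝ) (hK : 0 ≤ K) (hμ : 0 < μ)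
    (b : E → F) (r : E → ℝ)
    (hb : ∀ u v : E, ‖b u - b v‖ ≤ K * ‖u - v‖)
    (udia : F → E)
    (hconc : ∀ p : F, ConcaveOn ℝ Set.univ
      (fun u : E => ⟪p, b u⟫ - r u + (μ / 2) * ‖u‖ ^ 2))
    (hmax : ∀ p : F, ∀ u : E, ⟪p, b u⟫ - r u ≤ ⟪p, b (udia p)⟫ - r (udia p)) :
    ∀ p₁ p₂ : F, ‖udia p₁ - udia p₂‖ ≤ (K / μ) * ‖p₁ - p₂‖ := by
  intro p₁ p₂
  have growth (p : F) (u : E) :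
      ⟪p, b u⟫ - r u + μ / 2 * ‖udia p - u‖ ^ 2 ≤ ⟪p, b (udia p)⟫ - r (udia p) :=
    (strongConcaveOn_iff_convex.2 (hconc p)).add_sq_le_of_isMaxOn
      (Set.mem_univ _) (Set.mem_univ u) fun v _ => hmax p v
  have h₁ := growth p₁ (udia p₂)
  have h₂ := growth p₂ (udia p₁)
  rw [norm_sub_rev] at h₂
  have hinner : ⟪p₁ - p₂, b (udia p₁) - b (udia p₂)⟫ ≤
      ‖p₁ - p₂‖ * (K * ‖udia p₁ - udia p₂‖) :=
    (real_inner_le_norm _ _).trans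
      (mul_le_mul_of_nonneg_left (hb _ _) (norm_nonneg _))
  simp only [inner_sub_left, inner_sub_right] at hinner
  rcases (norm_nonneg (udia p₁ - udia p₂)).eq_or_lt with hd | hd
  · rw [← hd]
    positivity
  · rw [div_mul_eq_mul_div, le_div_iff₀ hμ]
    refine le_of_mul_le_mul_right ?_ hd
    linarith
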